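/- If u : ℝⁿ × [0,T) → ℝ solves the heat equation and at time 0 satisfies σ₁(D²u) > 0 and σ₂(D²u) > 0, and u has nice decay at infinity (so that the parabolic maximum principles apply and σ₁ > 0 persists), then σ₂(D²u)(·,t) ≥ 0 for all t ∈ (0,T). (Proposition on preservation of partial 2-convexity on ℝⁿ.) -/

import Mathlib

open scoped BigOperators
open Set

/-- i-th spatial partial derivative. -/
noncomputable def pd {n : ℕ} (i : Fin n) (f : (Fin n → ℝ) → ℝ) : (Fin n → ℝ) → ℝ :=
  fun x => fderiv ℝ f x (Pi.single i 1)

/-- Spatial Laplacian. -/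
noncomputable def lap {n : ℕ} (f : (Fin n → ℝ) → ℝ) : (Fin n → ℝ) → ℝ :=
  fun x => ∑ i, pd i (pd i f) x

/-- Hessian entry (j,k) of u(·,t). -/
noncomputable def hess {n : ℕ} (u : (Fin n → ℝ) → ℝ → ℝ) (j k : Fin n) :
    (Fin n → ℝ) → ℝ → ℝ :=
  fun x t => pd j (pd k (fun y => u y t)) x

/-- σ₂ of the spatial Hessian: ((Δu)² − trace((D²u)²))/2. -/
noncomputable def sigma2 {n : ℕ} (u : (Fin n → ℝ) → ℝ → ℝ) : (Fin n → ℝ) → ℝ → ℝ :=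
  fun x t => ((lap (fun y => u y t) x) ^ 2
    - ∑ j, ∑ k, hess u j k x t * hess u k j x t) / 2

open Filter Topology

/-- Directional derivative along a constant vector. -/
noncomputable def dirDeriv {E : Type*} [NormedAddCommGroup E] [NormedSpace ℝ E] (w : E)
    (f : E → ℝ) : E → ℝ :=
  fun p => fderiv ℝ f p w

section DirDeriv

variable {E : Type*} [NormedAddCommGroup E] [NormedSpace ℝ E] {f : E → ℝ}

lemma ContDiff.dirDeriv (hf : ContDiff ℝ (⊤ : ℕ∞) f) (w : E) :
    ContDiff ℝ (⊤ : ℕ∞) (dirDeriv w f) :=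
  (hf.fderiv_right (by simp)).clm_apply contDiff_const

lemma dirDeriv_comm (hf : ContDiff ℝ (⊤ : ℕ∞) f) (v w : E) :
    dirDeriv v (dirDeriv w f) = dirDeriv w (dirDeriv v f) := by
  funext p
  have hd : DifferentiableAt ℝ (fderiv ℝ f) p :=
    ((hf.fderiv_right (m := 1) (by norm_cast)).differentiable (by simp)) p
  have h (a b : E) : dirDeriv a (dirDeriv b f) p = fderiv ℝ (fderiv ℝ f) p a b := by
    change fderiv ℝ (fun y => fderiv ℝ f y b) p a = _
    rw [fderiv_clm_apply hd (differentiableAt_const b)]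
    simp
  rw [h, h]
  exact hf.contDiffAt.isSymmSndFDerivAt (by simp; norm_cast) v w

lemma dirDeriv_sum {ι : Type*} {s : Finset ι} {F : ι → E → ℝ}
    (hF : ∀ i ∈ s, ContDiff ℝ (⊤ : ℕ∞) (F i)) (w : E) :
    dirDeriv w (fun p => ∑ i ∈ s, F i p) = fun p => ∑ i ∈ s, dirDeriv w (F i) p := by
  funext p
  simp only [dirDeriv]
  rw [fderiv_fun_sum fun i hi => (hF i hi).differentiable (by simp) p]
  simp

lemma dirDeriv_const_mul (hf : ContDiff ℝ (⊤ : ℕ∞) f) (c : ℝ) (w : E) :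
    dirDeriv w (fun p => c * f p) = fun p => c * dirDeriv w f p := by
  funext p
  simp only [dirDeriv]
  rw [fderiv_const_mul (hf.differentiable (by simp) p)]
  simp

lemma hasDerivAt_dirDeriv (hf : ContDiff ℝ (⊤ : ℕ∞) f) (w p : E) (s : ℝ) :
    HasDerivAt (fun r : ℝ => f (p + r • w)) (dirDeriv w f (p + s • w)) s := by
  have h1 : HasDerivAt (fun r : ℝ => p + r • w) w s := by
    simpa using ((hasDerivAt_id s).smul_const w).const_add p
  exact ((hf.differentiable (by simp) _).hasFDerivAt).comp_hasDerivAt s h1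

end DirDeriv

/-- The second derivative is nonnegative at a local minimum. -/
lemma IsLocalMin.deriv_deriv_nonneg {g : ℝ → ℝ} {a : ℝ} (h : IsLocalMin g a)
    (hc : ContinuousAt g a) : 0 ≤ deriv (deriv g) a := by
  by_contra! hneg
  have hmax := isLocalMax_of_deriv_deriv_neg hneg h.deriv_eq_zero hc
  have heq : g =ᶠ[𝓝 a] fun _ => g a := by
    filter_upwards [h, hmax] with y h1 h2 using le_antisymm h2 h1
  rw [heq.deriv.deriv_eq] at hneg
  simp at hneg

section Slices

variable {n : ℕ} {U : (Fin n → ℝ) × ℝ → ℝ}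

/-- The spatial coordinate vectors in space-time. -/
noncomputable def spaceVec (i : Fin n) : (Fin n → ℝ) × ℝ := (Pi.single i 1, 0)

/-- The time direction in space-time. -/
def timeVec : (Fin n → ℝ) × ℝ := (0, 1)

lemma pd_slice (hU : ContDiff ℝ (⊤ : ℕ∞) U) (i : Fin n) (t : ℝ) :
    pd i (fun y => U (y, t)) = fun x => dirDeriv (spaceVec i) U (x, t) := by
  funext x
  have h1 : HasFDerivAt (fun y : Fin n → ℝ => (y, t))
      (ContinuousLinearMap.inl ℝ (Fin n → ℝ) ℝ) x := hasFDerivAt_prodMk_left x t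
  have h2 := ((hU.differentiable (by simp) (x, t)).hasFDerivAt).comp x h1
  have h3 : fderiv ℝ (fun y => U (y, t)) x = _ := h2.fderiv
  simp [pd, dirDeriv, spaceVec, h3]

lemma pd_pd_slice (hU : ContDiff ℝ (⊤ : ℕ∞) U) (j k : Fin n) (t : ℝ) :
    pd j (pd k (fun y => U (y, t))) =
      fun x => dirDeriv (spaceVec j) (dirDeriv (spaceVec k) U) (x, t) := by
  rw [pd_slice hU, pd_slice (hU.dirDeriv _)]

lemma deriv_slice (hU : ContDiff ℝ (⊤ : ℕ∞) U) (x : Fin n → ℝ) (t : ℝ) :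
    deriv (fun s => U (x, s)) t = dirDeriv timeVec U (x, t) := by
  have := (hasDerivAt_dirDeriv hU timeVec (x, 0) t).deriv
  simpa [timeVec] using this

/-- Minimum principle for the heat equation, for solutions tending to zero at spatial infinity. -/
lemma heat_nonneg {T : ℝ} (hU : ContDiff ℝ (⊤ : ℕ∞) U)
    (hheat : ∀ x, ∀ t ∈ Ico (0 : ℝ) T, dirDeriv timeVec U (x, t) =
      ∑ i, dirDeriv (spaceVec i) (dirDeriv (spaceVec i) U) (x, t))
    (hdecay : ∀ t₀ ∈ Ico (0 : ℝ) T, ∀ ε > (0 : ℝ), ∃ R : ℝ, ∀ x : Fin n → ℝ,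
      R ≤ ‖x‖ → ∀ t ∈ Icc (0 : ℝ) t₀, |U (x, t)| ≤ ε)
    (hinit : ∀ x, 0 ≤ U (x, 0)) (x : Fin n → ℝ) {t : ℝ} (ht : t ∈ Ico (0 : ℝ) T) :
    0 ≤ U (x, t) := by
  by_contra! hneg
  obtain ⟨ε, hε, hεt⟩ : ∃ ε > 0, U (x, t) + ε * t < U (x, t) / 2 := by
    refine ⟨-U (x, t) / (2 * (t + 1)), div_pos (by linarith) (by linarith [ht.1]), ?_⟩
    have h1 : 0 < t + 1 := by linarith [ht.1]
    have h2 : -U (x, t) / (2 * (t + 1)) * t = -U (x, t) / 2 * (t / (t + 1)) := by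
      field_simp
    have h3 : t / (t + 1) < 1 := by rw [div_lt_one h1]; linarith
    rw [h2]
    nlinarith
  obtain ⟨R, hR⟩ := hdecay t ht (-U (x, t) / 2) (by linarith)
  have hK : IsCompact (Metric.closedBall (0 : Fin n → ℝ) (max R ‖x‖) ×ˢ Icc (0 : ℝ) t) :=
    (isCompact_closedBall _ _).prod isCompact_Icc
  have hxt : (x, t) ∈ Metric.closedBall (0 : Fin n → ℝ) (max R ‖x‖) ×ˢ Icc (0 : ℝ) t :=
    ⟨by simp, ⟨ht.1, le_rfl⟩⟩
  obtain ⟨⟨y, s⟩, ⟨-, hs⟩, hmin⟩ := hK.exists_isMinOn ⟨_, hxt⟩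
    (f := fun p => U p + ε * p.2) (hU.continuous.add (by fun_prop)).continuousOn
  have hlt : U (y, s) + ε * s < U (x, t) / 2 := lt_of_le_of_lt (hmin hxt) hεt
  have hglob : ∀ z, ∀ r ∈ Icc (0 : ℝ) t, U (y, s) + ε * s ≤ U (z, r) + ε * r := by
    intro z r hr
    by_cases hz : ‖z‖ ≤ max R ‖x‖
    · exact hmin (show (z, r) ∈ _ from ⟨by simpa using hz, hr⟩)
    · have h1 := (abs_le.1 (hR z ((le_max_left _ _).trans (not_le.1 hz).le) r hr)).1
      have h2 := mul_nonneg hε.le hr.1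
      linarith
  have hs0 : 0 < s := by
    refine lt_of_le_of_ne hs.1 ?_
    rintro rfl
    have := hinit y
    linarith
  have hlap : 0 ≤ ∑ i, dirDeriv (spaceVec i) (dirDeriv (spaceVec i) U) (y, s) := by
    refine Finset.sum_nonneg fun i _ => ?_
    have hloc : IsLocalMin (fun r : ℝ => U ((y, s) + r • spaceVec i)) 0 := by
      refine Eventually.of_forall fun r => ?_
      have := hglob (y + r • Pi.single i 1) s hs
      simp only [spaceVec, Prod.smul_mk, Prod.mk_add_mk, smul_zero, add_zero, zero_smul]
      linarith
    have h1 : deriv (fun r : ℝ => U ((y, s) + r • spaceVec i)) =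
        fun r => dirDeriv (spaceVec i) U ((y, s) + r • spaceVec i) :=
      funext fun r => (hasDerivAt_dirDeriv hU _ _ r).deriv
    have h2 := hloc.deriv_deriv_nonneg (hasDerivAt_dirDeriv hU _ _ 0).continuousAt
    rw [h1, (hasDerivAt_dirDeriv (hU.dirDeriv _) _ _ 0).deriv] at h2
    simpa using h2
  have htime : dirDeriv timeVec U (y, s) + ε ≤ 0 := by
    have hd : HasDerivAt (fun r : ℝ => U (y, r) + ε * r)
        (dirDeriv timeVec U (y, s) + ε) s := by
      have h1 := hasDerivAt_dirDeriv hU timeVec (y, 0) s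
      simp only [timeVec, Prod.smul_mk, Prod.mk_add_mk, smul_zero, add_zero, zero_add,
        smul_eq_mul, mul_one] at h1
      exact h1.add (by simpa using (hasDerivAt_id s).const_mul ε)
    have hslope := hasDerivWithinAt_iff_tendsto_slope.1 (hd.hasDerivWithinAt (s := Iio s))
    rw [sdiff_singleton_eq_self (by simp)] at hslope
    refine le_of_tendsto hslope ?_
    filter_upwards [Ioo_mem_nhdsLT hs0] with r hr
    rw [slope_def_field]
    refine div_nonpos_of_nonneg_of_nonpos ?_ (by linarith [hr.2])
    have := hglob y r ⟨hr.1.le, hr.2.le.trans hs.2⟩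
    linarith
  have := hheat y s ⟨hs.1, hs.2.trans_lt ht.2⟩
  linarith

/-- Constant-coefficient combinations of the second spatial derivatives of a solution of the heat
equation again solve the heat equation. -/
lemma heat_second_derivs {T : ℝ} (hU : ContDiff ℝ (⊤ : ℕ∞) U)
    (hheat : ∀ x, ∀ t ∈ Ico (0 : ℝ) T, dirDeriv timeVec U (x, t) =
      ∑ i, dirDeriv (spaceVec i) (dirDeriv (spaceVec i) U) (x, t))
    (m : Fin n → Fin n → ℝ) (x : Fin n → ℝ) {t : ℝ} (ht : t ∈ Ico (0 : ℝ) T) :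
    dirDeriv timeVec (fun p => ∑ j, ∑ k, m j k *
        dirDeriv (spaceVec j) (dirDeriv (spaceVec k) U) p) (x, t) =
      ∑ i, dirDeriv (spaceVec i) (dirDeriv (spaceVec i) (fun p => ∑ j, ∑ k, m j k *
        dirDeriv (spaceVec j) (dirDeriv (spaceVec k) U) p)) (x, t) := by
  have hD (w w' : (Fin n → ℝ) × ℝ) : ContDiff ℝ (⊤ : ℕ∞) (dirDeriv w (dirDeriv w' U)) :=
    (hU.dirDeriv _).dirDeriv _
  have hlin (w : (Fin n → ℝ) × ℝ) {V : Fin n → Fin n → (Fin n → ℝ) × ℝ → ℝ}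
      (hV : ∀ j k, ContDiff ℝ (⊤ : ℕ∞) (V j k)) :
      dirDeriv w (fun p => ∑ j, ∑ k, m j k * V j k p) =
        fun p => ∑ j, ∑ k, m j k * dirDeriv w (V j k) p := by
    rw [dirDeriv_sum fun j _ => ContDiff.sum fun k _ => contDiff_const.mul (hV j k)]
    funext p
    refine Finset.sum_congr rfl fun j _ => ?_
    rw [dirDeriv_sum fun k _ => contDiff_const.mul (hV j k)]
    exact Finset.sum_congr rfl fun k _ => congrFun (dirDeriv_const_mul (hV j k) _ _) p
  have key (j k : Fin n) : dirDeriv timeVec (dirDeriv (spaceVec j) (dirDeriv (spaceVec k) U))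
      (x, t) = ∑ i, dirDeriv (spaceVec i) (dirDeriv (spaceVec i)
        (dirDeriv (spaceVec j) (dirDeriv (spaceVec k) U))) (x, t) := by
    rw [dirDeriv_comm (hU.dirDeriv _), dirDeriv_comm hU]
    rw [← congrFun (pd_pd_slice (hU.dirDeriv timeVec) j k t) x]
    have hL : ContDiff ℝ (⊤ : ℕ∞)
        (fun p => ∑ i, dirDeriv (spaceVec i) (dirDeriv (spaceVec i) U) p) :=
      ContDiff.sum fun i _ => hD _ _
    rw [show (fun y => dirDeriv timeVec U (y, t)) = fun y => ∑ i,
      dirDeriv (spaceVec i) (dirDeriv (spaceVec i) U) (y, t) from funext fun y => hheat y t ht]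
    rw [congrFun (pd_pd_slice hL j k t) x, dirDeriv_sum fun i _ => hD _ _,
      dirDeriv_sum fun i _ => (hD _ _).dirDeriv _]
    refine Finset.sum_congr rfl fun i _ => ?_
    rw [dirDeriv_comm (hU.dirDeriv _) (spaceVec k), dirDeriv_comm hU (spaceVec k),
      dirDeriv_comm ((hU.dirDeriv _).dirDeriv _) (spaceVec j),
      dirDeriv_comm (hU.dirDeriv _) (spaceVec j)]
  rw [hlin _ fun j k => hD _ _]
  have h2 (i : Fin n) := by
    have h := hlin (spaceVec i) fun j k => hD (spaceVec j) (spaceVec k)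
    have h' := hlin (spaceVec i) fun j k => (hD (spaceVec j) (spaceVec k)).dirDeriv (spaceVec i)
    exact congrFun ((congrArg (dirDeriv (spaceVec i)) h).trans h') (x, t)
  simp only [h2, key, Finset.mul_sum]
  rw [Finset.sum_comm]
  conv_rhs => rw [Finset.sum_comm]
  conv_lhs => rw [Finset.sum_comm]
  refine Finset.sum_congr rfl fun j _ => ?_
  rw [Finset.sum_comm]

end Slices

/-- Preservation of partial 2-convexity on ℝⁿ: if u solves the heat equation
with nice decay at infinity (u and its derivatives up to third order tend to 0
at spatial infinity, uniformly on compact time intervals), and at t = 0 one has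
σ₁(D²u) > 0 and σ₂(D²u) > 0, then σ₂(D²u) ≥ 0 for all t ∈ (0,T). -/
theorem partial_two_convexity_preserved (n : ℕ) (T : ℝ) (u : (Fin n → ℝ) → ℝ → ℝ)
    (hu : ContDiff ℝ (⊤ : ℕ∞) (fun p : (Fin n → ℝ) × ℝ => u p.1 p.2))
    (hheat : ∀ x, ∀ t ∈ Ico (0 : ℝ) T,
      deriv (fun s => u x s) t = lap (fun y => u y t) x)
    (hdecay : ∀ t₀ ∈ Ico (0 : ℝ) T, ∀ ε > (0 : ℝ), ∃ R : ℝ, ∀ x : Fin n → ℝ,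
      R ≤ ‖x‖ → ∀ t ∈ Icc (0 : ℝ) t₀,
        |u x t| + (∑ i, |pd i (fun y => u y t) x|)
          + (∑ i, ∑ j, |hess u i j x t|)
          + (∑ i, ∑ j, ∑ k, |pd i (fun y => hess u j k y t) x|) ≤ ε)
    (hsigma1 : ∀ x, 0 < lap (fun y => u y 0) x)
    (hsigma2 : ∀ x, 0 < sigma2 u x 0) :
    ∀ x, ∀ t ∈ Ioo (0 : ℝ) T, 0 ≤ sigma2 u x t := by
  intro x t ht
  set U : (Fin n → ℝ) × ℝ → ℝ := fun p => u p.1 p.2 with hUdef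
  have hess_eq (j k : Fin n) (y : Fin n → ℝ) (s : ℝ) :
      hess u j k y s = dirDeriv (spaceVec j) (dirDeriv (spaceVec k) U) (y, s) :=
    congrFun (pd_pd_slice hu j k s) y
  have lap_eq (y : Fin n → ℝ) (s : ℝ) : lap (fun y => u y s) y = ∑ i, hess u i i y s := rfl
  have symm (j k : Fin n) (y : Fin n → ℝ) (s : ℝ) : hess u j k y s = hess u k j y s := by
    rw [hess_eq, hess_eq, dirDeriv_comm hu]
  have hheatU : ∀ y, ∀ s ∈ Ico (0 : ℝ) T, dirDeriv timeVec U (y, s) =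
      ∑ i, dirDeriv (spaceVec i) (dirDeriv (spaceVec i) U) (y, s) := by
    intro y s hs
    rw [← deriv_slice hu y s]
    refine (hheat y s hs).trans ?_
    rw [lap_eq]
    exact Finset.sum_congr rfl fun i _ => hess_eq i i y s
  have sigma2_eq (y : Fin n → ℝ) (s : ℝ) :
      sigma2 u y s = ((∑ i, hess u i i y s) ^ 2 - ∑ j, ∑ k, hess u j k y s ^ 2) / 2 := by
    unfold sigma2
    rw [lap_eq]
    congr 2
    refine Finset.sum_congr rfl fun j _ => Finset.sum_congr rfl fun k _ => ?_
    rw [symm k j, sq]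
  set q : ℝ := ∑ j, ∑ k, hess u j k x t ^ 2 with hq
  have hq0 : 0 ≤ q := Finset.sum_nonneg fun _ _ => Finset.sum_nonneg fun _ _ => sq_nonneg _
  set m : Fin n → Fin n → ℝ := fun j k => (if j = k then √q else 0) - hess u j k x t with hm
  set V : (Fin n → ℝ) × ℝ → ℝ := fun p => ∑ j, ∑ k, m j k *
    dirDeriv (spaceVec j) (dirDeriv (spaceVec k) U) p with hVdef
  have hV : ContDiff ℝ (⊤ : ℕ∞) V := ContDiff.sum fun j _ => ContDiff.sum fun k _ =>
    contDiff_const.mul ((hu.dirDeriv _).dirDeriv _)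
  have V_eq' (y : Fin n → ℝ) (s : ℝ) : V (y, s) = ∑ j, ∑ k, m j k * hess u j k y s := by
    simp only [hVdef, hess_eq]
  have V_eq (y : Fin n → ℝ) (s : ℝ) : V (y, s) =
      √q * (∑ i, hess u i i y s) - ∑ j, ∑ k, hess u j k x t * hess u j k y s := by
    rw [V_eq']
    simp [hm, sub_mul, Finset.sum_sub_distrib, ite_mul, Finset.mul_sum]
  have hVnonneg : 0 ≤ V (x, t) := by
    refine heat_nonneg hV (fun y s hs => heat_second_derivs hu hheatU m y hs) ?_ ?_ x
      ⟨ht.1.le, ht.2⟩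
    · intro t₀ ht₀ ε hε
      set M : ℝ := ∑ j, ∑ k, |m j k| with hM
      have hM0 : 0 ≤ M := Finset.sum_nonneg fun _ _ => Finset.sum_nonneg fun _ _ => abs_nonneg _
      have hmM (j k : Fin n) : |m j k| ≤ M :=
        (Finset.single_le_sum (f := fun k => |m j k|) (fun _ _ => abs_nonneg _)
          (Finset.mem_univ k)).trans
        (Finset.single_le_sum (f := fun j => ∑ k, |m j k|)
          (fun _ _ => Finset.sum_nonneg fun _ _ => abs_nonneg _) (Finset.mem_univ j))
      obtain ⟨R, hR⟩ := hdecay t₀ ht₀ (ε / (M + 1)) (by positivity)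
      refine ⟨R, fun y hy s hs => ?_⟩
      have h1 := hR y hy s hs
      have h2 : ∑ i, ∑ j, |hess u i j y s| ≤ ε / (M + 1) := by
        have a1 := abs_nonneg (u y s)
        have a2 : 0 ≤ ∑ i, |pd i (fun y => u y s) y| := Finset.sum_nonneg fun _ _ => abs_nonneg _
        have a3 : 0 ≤ ∑ i, ∑ j, ∑ k, |pd i (fun y => hess u j k y s) y| :=
          Finset.sum_nonneg fun _ _ => Finset.sum_nonneg fun _ _ =>
            Finset.sum_nonneg fun _ _ => abs_nonneg _
        linarith
      calc |V (y, s)| ≤ ∑ j, ∑ k, |m j k * hess u j k y s| := by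
            rw [V_eq']
            exact (Finset.abs_sum_le_sum_abs _ _).trans
              (Finset.sum_le_sum fun j _ => Finset.abs_sum_le_sum_abs _ _)
        _ ≤ ∑ j, ∑ k, M * |hess u j k y s| := by
            gcongr with j _ k _
            rw [abs_mul]
            gcongr
            exact hmM j k
        _ = M * ∑ j, ∑ k, |hess u j k y s| := by simp only [Finset.mul_sum]
        _ ≤ (M + 1) * (ε / (M + 1)) := by gcongr; linarith
        _ = ε := by field_simp
    · intro y
      have h1 : 0 < ∑ i, hess u i i y 0 := hsigma1 y
      have h2 := hsigma2 y
      rw [sigma2_eq] at h2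
      rw [V_eq, sub_nonneg]
      have hcs : (∑ j, ∑ k, hess u j k x t * hess u j k y 0) ^ 2 ≤
          q * ∑ j, ∑ k, hess u j k y 0 ^ 2 := by
        have := Finset.sum_mul_sq_le_sq_mul_sq (Finset.univ : Finset (Fin n × Fin n))
          (fun p => hess u p.1 p.2 x t) (fun p => hess u p.1 p.2 y 0)
        simpa only [Fintype.sum_prod_type] using this
      refine le_of_sq_le_sq ?_ (by positivity)
      rw [mul_pow, Real.sq_sqrt hq0]
      refine hcs.trans ?_
      gcongr
      linarith
  rw [V_eq] at hVnonneg
  simp only [← sq] at hVnonneg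
  rw [← hq] at hVnonneg
  rw [sigma2_eq, ← hq]
  rcases hq0.eq_or_lt with h0 | h0
  · rw [← h0, sub_zero]
    positivity
  · have hs : 0 < √q := Real.sqrt_pos.2 h0
    have hsq : √q ^ 2 = q := Real.sq_sqrt hq0
    have : √q ≤ ∑ i, hess u i i x t := by
      refine le_of_mul_le_mul_left ?_ hs
      linarith
    nlinarith
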